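/- Let (P_t) be a tracially symmetric quantum Markov semigroup on M_n(ℂ) whose generator has the Lindblad form L = ∑_{j=1}^d ∂_j†∂_j. If (P_t) satisfies the K-intertwining condition for some K ∈ ℝ, then (P_t) satisfies CBE(K,d): for every m and all x_1,…,x_m ∈ M_n(ℂ), [Γ₂(x_j,x_k)]_{j,k} ≥ K·[Γ(x_j,x_k)]_{j,k} + (1/d)·[(L x_j)*(L x_k)]_{j,k} in M_m(M_n(ℂ)). -/

import Mathlib

open Matrix Filter
open scoped ComplexOrder ENNReal Kronecker

namespace CD

abbrev Mat (ι : Type*) := Matrix ι ι ℂ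

variable {ι : Type*}

noncomputable def trn [Fintype ι] (x : Mat ι) : ℂ :=
  (Fintype.card ι : ℂ)⁻¹ * x.trace

noncomputable def inn [Fintype ι] (x y : Mat ι) : ℂ := trn (xᴴ * y)

def matLE [Fintype ι] (A B : Mat ι) : Prop := (B - A).PosSemidef

def blockify [Fintype ι] {m : ℕ} (B : Fin m → Fin m → Mat ι) :
    Matrix (Fin m × ι) (Fin m × ι) ℂ :=
  Matrix.of fun p q => B p.1 q.1 p.2 q.2

def IsCP [Fintype ι] (Φ : Mat ι →ₗ[ℂ] Mat ι) : Prop :=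
  ∀ (m : ℕ) (B : Fin m → Fin m → Mat ι),
    (blockify B).PosSemidef → (blockify fun j k => Φ (B j k)).PosSemidef

structure QMS (ι : Type*) [Fintype ι] [DecidableEq ι] where
  P : ℝ → Mat ι →ₗ[ℂ] Mat ι
  gen : Mat ι →ₗ[ℂ] Mat ι
  P_zero : P 0 = LinearMap.id
  P_add : ∀ s t : ℝ, P (s + t) = (P s) ∘ₗ (P t)
  P_cp : ∀ t : ℝ, 0 ≤ t → IsCP (P t)
  P_unital : ∀ t : ℝ, 0 ≤ t → P t 1 = 1
  P_cont : ∀ (x : Mat ι) (i j : ι), Continuous fun t : ℝ => P t x i j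
  P_deriv : ∀ (x : Mat ι) (i j : ι),
    HasDerivAt (fun t : ℝ => P t x i j) (-(gen x i j)) 0

variable [Fintype ι] [DecidableEq ι]

def TraciallySymm (Q : QMS ι) : Prop :=
  ∀ t : ℝ, 0 ≤ t → ∀ x y : Mat ι, trn (Q.P t x * y) = trn (x * Q.P t y)

noncomputable def Gamma (L : Mat ι →ₗ[ℂ] Mat ι) (a b : Mat ι) : Mat ι :=
  (2:ℂ)⁻¹ • (aᴴ * L b + (L a)ᴴ * b - L (aᴴ * b))

noncomputable def Gamma2 (L : Mat ι →ₗ[ℂ] Mat ι) (a b : Mat ι) : Mat ι :=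
  (2:ℂ)⁻¹ • (Gamma L a (L b) + Gamma L (L a) b - L (Gamma L a b))

noncomputable def BE (L : Mat ι →ₗ[ℂ] Mat ι) (K ν : ℝ) : Prop :=
  ∀ a : Mat ι, matLE (K • Gamma L a a + ν • ((L a)ᴴ * (L a))) (Gamma2 L a a)

noncomputable def cK (K t : ℝ) : ℝ :=
  if K = 0 then 2 * t else (1 - Real.exp (-(2 * K * t))) / K

noncomputable def comm (v x : Mat ι) : Mat ι := v * x - x * v

def LindbladForm (L : Mat ι →ₗ[ℂ] Mat ι) {d : ℕ} (v : Fin d → Mat ι) : Prop :=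
  (∀ j, ∃ k, (v j)ᴴ = v k) ∧ ∀ x, L x = ∑ j, comm ((v j)ᴴ) (comm (v j) x)

def Intertwining (Q : QMS ι) {d : ℕ} (v : Fin d → Mat ι) (K : ℝ) : Prop :=
  ∀ t : ℝ, 0 ≤ t → ∀ (j : Fin d) (x : Mat ι),
    comm (v j) (Q.P t x) = Real.exp (-(K * t)) • Q.P t (comm (v j) x)

def CBE (L : Mat ι →ₗ[ℂ] Mat ι) (K ν : ℝ) : Prop :=
  ∀ (m : ℕ) (x : Fin m → Mat ι),
    (blockify (fun j k => Gamma2 L (x j) (x k)) -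
      (K • blockify (fun j k => Gamma L (x j) (x k)) +
       ν • blockify (fun j k => (L (x j))ᴴ * (L (x k))))).PosSemidef

def IsDensity (ρ : Mat ι) : Prop := ρ.PosSemidef ∧ trn ρ = 1

def IsInvDensity (ρ : Mat ι) : Prop := ρ.PosDef ∧ trn ρ = 1

def sliceL {κ : Type*} (x : Mat (ι × κ)) (a b : κ) : Mat ι :=
  Matrix.of fun i j => x (i, a) (j, b)

def sliceR {κ : Type*} (x : Mat (κ × ι)) (a b : κ) : Mat ι :=
  Matrix.of fun i j => x (a, i) (b, j)

noncomputable def lTensor (Φ : Mat ι →ₗ[ℂ] Mat ι) (κ : Type*) :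
    Mat (ι × κ) →ₗ[ℂ] Mat (ι × κ) where
  toFun x := Matrix.of fun p q => Φ (sliceL x p.2 q.2) p.1 q.1
  map_add' x y := by
    ext p q
    have h : sliceL (x + y) p.2 q.2 = sliceL x p.2 q.2 + sliceL y p.2 q.2 := rfl
    simp only [Matrix.of_apply, h, map_add, Matrix.add_apply]
  map_smul' c x := by
    ext p q
    have h : sliceL (c • x) p.2 q.2 = c • sliceL x p.2 q.2 := rfl
    simp only [Matrix.of_apply, h, _root_.map_smul, Matrix.smul_apply, RingHom.id_apply]

noncomputable def rTensor (Ψ : Mat ι →ₗ[ℂ] Mat ι) (κ : Type*) :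
    Mat (κ × ι) →ₗ[ℂ] Mat (κ × ι) where
  toFun x := Matrix.of fun p q => Ψ (sliceR x p.1 q.1) p.2 q.2
  map_add' x y := by
    ext p q
    have h : sliceR (x + y) p.1 q.1 = sliceR x p.1 q.1 + sliceR y p.1 q.1 := rfl
    simp only [Matrix.of_apply, h, map_add, Matrix.add_apply]
  map_smul' c x := by
    ext p q
    have h : sliceR (c • x) p.1 q.1 = c • sliceR x p.1 q.1 := rfl
    simp only [Matrix.of_apply, h, _root_.map_smul, Matrix.smul_apply, RingHom.id_apply]

end CD

namespace CD

section PosSemidef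

variable {α β : Type*} [Fintype α] [Finite β]

/-- The operator-valued Cauchy–Schwarz inequality for a finite sum of matrices. -/
theorem posSemidef_sum_sub_inv_smul {d : ℕ} (T : Fin d → Matrix α β ℂ) :
    (∑ j, (T j)ᴴ * T j - (d : ℂ)⁻¹ • ((∑ j, T j)ᴴ * ∑ j, T j)).PosSemidef := by
  rcases Nat.eq_zero_or_pos d with rfl | hd
  · simpa using Matrix.PosSemidef.zero
  have hd' : (d : ℂ) ≠ 0 := by exact_mod_cast hd.ne'
  set S := ∑ j, T j with hS
  have key : ∑ j, (T j)ᴴ * T j - (d : ℂ)⁻¹ • (Sᴴ * S) =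
      ∑ j, (T j - (d : ℂ)⁻¹ • S)ᴴ * (T j - (d : ℂ)⁻¹ • S) := by
    have hexp : ∀ j, (T j - (d : ℂ)⁻¹ • S)ᴴ * (T j - (d : ℂ)⁻¹ • S) =
        (T j)ᴴ * T j - (d : ℂ)⁻¹ • ((T j)ᴴ * S) - (d : ℂ)⁻¹ • (Sᴴ * T j)
          + ((d : ℂ)⁻¹ * (d : ℂ)⁻¹) • (Sᴴ * S) := by
      intro j
      simp only [conjTranspose_sub, conjTranspose_smul, Matrix.sub_mul, Matrix.mul_sub,
        Matrix.smul_mul, Matrix.mul_smul, star_inv₀, star_natCast]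
      module
    simp only [hexp, Finset.sum_add_distrib, Finset.sum_sub_distrib, ← Finset.smul_sum,
      ← Matrix.sum_mul, ← Matrix.mul_sum, ← conjTranspose_sum, ← hS, Finset.sum_const,
      Finset.card_univ, Fintype.card_fin]
    rw [← Nat.cast_smul_eq_nsmul ℂ, smul_smul, inv_mul_cancel_right₀ hd']
    abel
  rw [key]
  exact Matrix.posSemidef_sum _ fun j _ => Matrix.posSemidef_conjTranspose_mul_self _

theorem posSemidef_sum_sum_sub_inv_smul {d : ℕ} (T : Fin d → Fin d → Matrix α β ℂ)
    (σ : Fin d → Fin d) (S : Matrix α β ℂ) (hS : ∑ j, T j (σ j) = S) :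
    (∑ j, ∑ k, (T j k)ᴴ * T j k - (d : ℂ)⁻¹ • (Sᴴ * S)).PosSemidef := by
  have h1 := posSemidef_sum_sub_inv_smul fun j => T j (σ j)
  rw [hS] at h1
  have h2 : (∑ j, ∑ k ∈ Finset.univ.erase (σ j), (T j k)ᴴ * T j k).PosSemidef :=
    Matrix.posSemidef_sum _ fun j _ => Matrix.posSemidef_sum _ fun k _ =>
      Matrix.posSemidef_conjTranspose_mul_self _
  convert h1.add h2 using 1
  have h3 : ∀ j, ∑ k, (T j k)ᴴ * T j k = (T j (σ j))ᴴ * T j (σ j) +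
      ∑ k ∈ Finset.univ.erase (σ j), (T j k)ᴴ * T j k := fun j =>
    (Finset.add_sum_erase _ _ (Finset.mem_univ _)).symm
  simp only [h3, Finset.sum_add_distrib]
  abel

end PosSemidef

section Blocks

variable {ι : Type*} {m : ℕ}

/-- The block row with entries `c 0, …, c (m - 1)`. -/
def blockRow (c : Fin m → Mat ι) : Matrix ι (Fin m × ι) ℂ :=
  Matrix.of fun i p => c p.1 i p.2

theorem blockRow_conjTranspose_mul [Fintype ι] (c : Fin m → Mat ι) :
    (blockRow c)ᴴ * blockRow c = blockify fun j k => (c j)ᴴ * c k := by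
  ext p q
  simp [blockRow, blockify, Matrix.mul_apply]

theorem blockRow_sum {κ : Type*} (s : Finset κ) (c : κ → Fin m → Mat ι) :
    blockRow (fun k => ∑ j ∈ s, c j k) = ∑ j ∈ s, blockRow (c j) := by
  ext p q
  simp [blockRow, Matrix.sum_apply]

/-- Completely positive maps commute with the adjoint. -/
theorem IsCP.map_conjTranspose [Fintype ι] [DecidableEq ι] {Φ : Mat ι →ₗ[ℂ] Mat ι} (hΦ : IsCP Φ)
    (x : Mat ι) : Φ xᴴ = (Φ x)ᴴ := by
  have h := hΦ 2 (fun j k => (![1, x] j)ᴴ * ![1, x] k) (by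
    rw [← blockRow_conjTranspose_mul]
    exact Matrix.posSemidef_conjTranspose_mul_self _)
  ext i j
  have h2 := h.isHermitian.apply ((1 : Fin 2), i) ((0 : Fin 2), j)
  simpa [blockify] using h2.symm

end Blocks

section Generator

variable {ι : Type*} [Fintype ι] [DecidableEq ι]

theorem QMS.gen_conjTranspose (Q : QMS ι) (x : Mat ι) : Q.gen xᴴ = (Q.gen x)ᴴ := by
  ext i j
  have h1 := (Q.P_deriv xᴴ i j).hasDerivWithinAt (s := Set.Ici 0)
  have h2 := (Q.P_deriv x j i).star.hasDerivWithinAt (s := Set.Ici 0)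
  have h3 : HasDerivWithinAt (fun t : ℝ => Q.P t xᴴ i j) (star (-(Q.gen x j i)))
      (Set.Ici 0) 0 :=
    h2.congr (fun t ht => by rw [(Q.P_cp t ht).map_conjTranspose]; rfl)
      (by rw [(Q.P_cp 0 le_rfl).map_conjTranspose]; rfl)
  have h4 := (uniqueDiffWithinAt_Ici (0 : ℝ)).eq_deriv _ h1 h3
  rw [star_neg, neg_inj] at h4
  exact h4

theorem comm_gen_of_intertwining (Q : QMS ι) {d : ℕ} {v : Fin d → Mat ι} {K : ℝ}
    (hint : Intertwining Q v K) (j : Fin d) (x : Mat ι) :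
    comm (v j) (Q.gen x) = Q.gen (comm (v j) x) + (K : ℂ) • comm (v j) x := by
  ext a b
  have h1 : HasDerivAt (fun t : ℝ => comm (v j) (Q.P t x) a b)
      (-(comm (v j) (Q.gen x) a b)) 0 := by
    have h : HasDerivAt (fun t : ℝ => ∑ l, v j a l * Q.P t x l b - ∑ l, Q.P t x a l * v j l b)
        (∑ l, v j a l * -(Q.gen x l b) - ∑ l, -(Q.gen x a l) * v j l b) 0 :=
      (HasDerivAt.fun_sum fun l _ => (Q.P_deriv x l b).const_mul _).sub
        (HasDerivAt.fun_sum fun l _ => (Q.P_deriv x a l).mul_const _)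
    have hcomm : ∀ y : Mat ι, comm (v j) y a b =
        ∑ l, v j a l * y l b - ∑ l, y a l * v j l b := fun _ => rfl
    simp only [mul_neg, neg_mul, Finset.sum_neg_distrib, ← neg_sub', ← hcomm] at h
    exact h
  have he : HasDerivAt (fun t : ℝ => ((Real.exp (-(K * t)) : ℝ) : ℂ)) ((-K : ℝ) : ℂ) 0 := by
    refine HasDerivAt.ofReal_comp ?_
    simpa using (((hasDerivAt_id (0 : ℝ)).const_mul K).neg).exp
  have h2 := he.mul (Q.P_deriv (comm (v j) x) a b)
  have h3 := h2.hasDerivWithinAt (s := Set.Ici 0)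
  have h4 : HasDerivWithinAt (fun t : ℝ => comm (v j) (Q.P t x) a b) _ (Set.Ici 0) 0 :=
    h3.congr (fun t ht => by rw [hint t ht j x]; simp [Matrix.smul_apply])
      (by rw [hint 0 le_rfl j x]; simp [Matrix.smul_apply])
  have h5 := (uniqueDiffWithinAt_Ici (0 : ℝ)).eq_deriv _ h1.hasDerivWithinAt h4
  simp only [Q.P_zero, LinearMap.id_apply, mul_zero, neg_zero, Real.exp_zero] at h5
  simp only [Matrix.add_apply, Matrix.smul_apply, smul_eq_mul]
  push_cast at h5
  linear_combination -h5

variable {d : ℕ}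

/-- A family of matrices followed by the family of its adjoints. -/
def withAdjoints (v : Fin d → Mat ι) : Fin d ⊕ Fin d → Mat ι :=
  Sum.elim v fun j => (v j)ᴴ

theorem Gamma_eq_sum {L : Mat ι →ₗ[ℂ] Mat ι} {v : Fin d → Mat ι}
    (hL : ∀ x, L x = ∑ j, comm ((v j)ᴴ) (comm (v j) x))
    (hstar : ∀ x, L xᴴ = (L x)ᴴ) (a b : Mat ι) :
    Gamma L a b = (2 : ℂ)⁻¹ •
      ∑ p, (comm (withAdjoints v p) a)ᴴ * comm (withAdjoints v p) b := by
  rw [Gamma, ← hstar, hL, hL, hL, Fintype.sum_sum_type]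
  simp only [withAdjoints, Sum.elim_inl, Sum.elim_inr, Finset.mul_sum, Finset.sum_mul,
    ← Finset.sum_add_distrib, ← Finset.sum_sub_distrib]
  congr 1
  refine Finset.sum_congr rfl fun j _ => ?_
  simp only [comm, conjTranspose_sub, conjTranspose_mul, conjTranspose_conjTranspose]
  noncomm_ring

theorem Gamma2_eq_add_sum {ι κ : Type*} [Fintype ι] [Fintype κ] {L : Mat ι →ₗ[ℂ] Mat ι}
    {w : κ → Mat ι}
    {K : ℝ} (hΓ : ∀ a b, Gamma L a b = (2 : ℂ)⁻¹ • ∑ p, (comm (w p) a)ᴴ * comm (w p) b)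
    (hK : ∀ p x, comm (w p) (L x) = L (comm (w p) x) + (K : ℂ) • comm (w p) x)
    (a b : Mat ι) :
    Gamma2 L a b = (K : ℂ) • Gamma L a b +
      (2 : ℂ)⁻¹ • ∑ p, Gamma L (comm (w p) a) (comm (w p) b) := by
  rw [Gamma2, hΓ a b, hΓ a (L b), hΓ (L a) b]
  simp only [Gamma, map_smul, map_sum, hK, smul_smul, Finset.smul_sum,
    ← Finset.sum_add_distrib, ← Finset.sum_sub_distrib]
  refine Finset.sum_congr rfl fun p _ => ?_
  simp only [conjTranspose_add, conjTranspose_smul, Matrix.mul_add, Matrix.add_mul,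
    Matrix.mul_smul, Matrix.smul_mul, RCLike.star_def, Complex.conj_ofReal]
  module

end Generator


/-- A tracially symmetric quantum Markov semigroup on `Mₙ(ℂ)` whose
generator has Lindblad form with `d` partial derivatives and which satisfies the
`K`-intertwining condition satisfies the complete Bakry–Émery condition `CBE(K,d)`. -/
theorem CBE_of_intertwining {n d : ℕ} (Q : QMS (Fin n)) (hsymm : TraciallySymm Q)
    (v : Fin d → Mat (Fin n)) (hLind : LindbladForm Q.gen v) (K : ℝ)
    (hint : Intertwining Q v K) :
    CBE Q.gen K (d : ℝ)⁻¹ := by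
  obtain ⟨hadj, hL⟩ := hLind
  choose σ hσ using hadj
  have hstar := Q.gen_conjTranspose
  have hΓ := Gamma_eq_sum hL hstar
  have hK : ∀ p x, comm (withAdjoints v p) (Q.gen x) =
      Q.gen (comm (withAdjoints v p) x) + (K : ℂ) • comm (withAdjoints v p) x := by
    rintro (j | j) x
    · exact comm_gen_of_intertwining Q hint j x
    · simpa only [withAdjoints, Sum.elim_inr, hσ] using comm_gen_of_intertwining Q hint (σ j) x
  have hL' : ∀ x, Q.gen x = ∑ j, comm (v j) (comm ((v j)ᴴ) x) := by
    intro x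
    have h := hstar xᴴ
    rw [conjTranspose_conjTranspose] at h
    rw [h, hL, conjTranspose_sum]
    refine Finset.sum_congr rfl fun j _ => ?_
    simp only [comm, conjTranspose_sub, conjTranspose_mul, conjTranspose_conjTranspose]
    noncomm_ring
  intro m x
  let T (p q : Fin d ⊕ Fin d) : Matrix (Fin n) (Fin m × Fin n) ℂ :=
    blockRow fun k => comm (withAdjoints v q) (comm (withAdjoints v p) (x k))
  let S : Matrix (Fin n) (Fin m × Fin n) ℂ := blockRow fun k => Q.gen (x k)
  have hll := posSemidef_sum_sum_sub_inv_smul (fun j k => T (.inl j) (.inl k)) σ S (by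
    simp only [T, S, ← blockRow_sum, withAdjoints, Sum.elim_inl, ← hσ, ← hL])
  have hlr := posSemidef_sum_sum_sub_inv_smul (fun j k => T (.inl j) (.inr k)) id S (by
    simp only [T, S, ← blockRow_sum, withAdjoints, Sum.elim_inl, Sum.elim_inr, id, ← hL])
  have hrl := posSemidef_sum_sum_sub_inv_smul (fun j k => T (.inr j) (.inl k)) id S (by
    simp only [T, S, ← blockRow_sum, withAdjoints, Sum.elim_inl, Sum.elim_inr, id, ← hL'])
  have hrr := posSemidef_sum_sum_sub_inv_smul (fun j k => T (.inr j) (.inr k)) σ S (by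
    simp only [T, S, ← blockRow_sum, withAdjoints, Sum.elim_inr, ← hσ,
      conjTranspose_conjTranspose, ← hL'])
  have hsum := (((hll.add hlr).add hrl).add hrr).smul
    (show (0 : ℂ) ≤ 4⁻¹ by rw [inv_nonneg]; norm_num)
  convert hsum using 1
  have hsplit : ∑ p, ∑ q, (T p q)ᴴ * T p q =
      ∑ j, ∑ k, (T (.inl j) (.inl k))ᴴ * T (.inl j) (.inl k) +
      ∑ j, ∑ k, (T (.inl j) (.inr k))ᴴ * T (.inl j) (.inr k) +
      ∑ j, ∑ k, (T (.inr j) (.inl k))ᴴ * T (.inr j) (.inl k) +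
      ∑ j, ∑ k, (T (.inr j) (.inr k))ᴴ * T (.inr j) (.inr k) := by
    simp only [Fintype.sum_sum_type, Finset.sum_add_distrib]
    abel
  have hΓ₂ : blockify (fun j k => Gamma2 Q.gen (x j) (x k)) =
      K • blockify (fun j k => Gamma Q.gen (x j) (x k)) +
        (4 : ℂ)⁻¹ • ∑ p, ∑ q, (T p q)ᴴ * T p q := by
    ext r s
    simp only [T, blockRow_conjTranspose_mul, blockify, Gamma2_eq_add_sum hΓ hK]
    simp only [hΓ (comm _ _), Matrix.add_apply, Matrix.smul_apply, Matrix.sum_apply,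
      Matrix.of_apply, ← Finset.smul_sum, smul_smul, Complex.real_smul, smul_eq_mul]
    norm_num
  have hS : blockify (fun j k => (Q.gen (x j))ᴴ * Q.gen (x k)) = Sᴴ * S :=
    (blockRow_conjTranspose_mul _).symm
  have hd : ((d : ℝ)⁻¹ : ℝ) • (Sᴴ * S) = (d : ℂ)⁻¹ • (Sᴴ * S) := by
    ext r s
    simp [Matrix.smul_apply]
  rw [hΓ₂, hS, hd, hsplit]
  module

end CD
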